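/- arXiv:1502.07769 — 4 statements merged into one kernel-verified Lean document; each statement's English description precedes it below -/
import Mathlib

section
/- Let A and B be countable relational structures such that the polymorphism clone Pol(A) has a strong gate covering. Let h : Pol(A) → Pol(B) be a clone homomorphism whose restriction to the closure of Aut(A) inside the unary part of Pol(A) is continuous. Then h is continuous. -/
set_option autoImplicit false

/-! ## Relational signatures and structures -/

structure RelSig where
  symbols : Type
  arity : symbols → ℕ

structure RelStr (σ : RelSig) where
  carrier : Type
  rel : ∀ s : σ.symbols, Set (Fin (σ.arity s) → carrier)

namespace RelStr

variable {σ : RelSig}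

/-- Homomorphisms of relational structures. -/
def IsHom (A B : RelStr σ) (h : A.carrier → B.carrier) : Prop :=
  ∀ (s : σ.symbols) (t : Fin (σ.arity s) → A.carrier),
    t ∈ A.rel s → (fun j => h (t j)) ∈ B.rel s

/-- Embeddings of relational structures. -/
def IsEmb (A B : RelStr σ) (h : A.carrier → B.carrier) : Prop :=
  Function.Injective h ∧
    ∀ (s : σ.symbols) (t : Fin (σ.arity s) → A.carrier),
      t ∈ A.rel s ↔ (fun j => h (t j)) ∈ B.rel s

/-- Automorphisms: surjective self-embeddings. -/
def IsAut (A : RelStr σ) (h : A.carrier → A.carrier) : Prop :=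
  Function.Surjective h ∧ IsEmb A A h

/-- The n-th direct power of a relational structure. -/
def pow (A : RelStr σ) (n : ℕ) : RelStr σ where
  carrier := Fin n → A.carrier
  rel s := {t | ∀ i : Fin n, (fun j => t j i) ∈ A.rel s}

/-- The direct product of two relational structures. -/
def prod (A B : RelStr σ) : RelStr σ where
  carrier := A.carrier × B.carrier
  rel s := {t | (fun j => (t j).1) ∈ A.rel s ∧ (fun j => (t j).2) ∈ B.rel s}

/-- `A.inAge B` : `B` belongs to the age of `A`, i.e. `B` is finite and embeddable into `A`. -/
def inAge (A B : RelStr σ) : Prop :=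
  Finite B.carrier ∧ ∃ h : B.carrier → A.carrier, IsEmb B A h

/-- `Younger A U` : the age of `A` is contained in the age of `U`. -/
def Younger (A U : RelStr σ) : Prop :=
  ∀ B : RelStr σ, inAge A B → inAge U B

/-- Homogeneity: any two embeddings of a member of the age differ by an automorphism. -/
def IsHomogeneous (U : RelStr σ) : Prop :=
  ∀ B : RelStr σ, inAge U B →
    ∀ ι₁ ι₂ : B.carrier → U.carrier, IsEmb B U ι₁ → IsEmb B U ι₂ →
      ∃ h : U.carrier → U.carrier, IsAut U h ∧ ∀ b, h (ι₁ b) = ι₂ b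

/-- ω-categoricity of a countable structure, rendered via the
Engeler–Ryll-Nardzewski–Svenonius theorem: the automorphism group is oligomorphic,
i.e. has finitely many orbits on `n`-tuples for every `n`. -/
def IsOligomorphic (U : RelStr σ) : Prop :=
  ∀ n : ℕ, ∃ (k : ℕ) (reps : Fin k → (Fin n → U.carrier)),
    ∀ t : Fin n → U.carrier, ∃ (j : Fin k) (h : U.carrier → U.carrier),
      IsAut U h ∧ ∀ i, h (reps j i) = t i

/-- The automorphism group acts transitively on the carrier. -/
def AutTransitive (U : RelStr σ) : Prop :=
  ∀ x y : U.carrier, ∃ h : U.carrier → U.carrier, IsAut U h ∧ h x = y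

/-- `D` (with embeddings `g₁, g₂`) is the amalgamated free sum of `B₁` and `B₂`
over `A` (with embeddings `f₁, f₂`): the carriers are glued exactly along `A`, and
every relation of `D` comes from `B₁` or from `B₂`. -/
def IsFreeAmalgam (A B₁ B₂ D : RelStr σ)
    (f₁ : A.carrier → B₁.carrier) (f₂ : A.carrier → B₂.carrier)
    (g₁ : B₁.carrier → D.carrier) (g₂ : B₂.carrier → D.carrier) : Prop :=
  IsEmb B₁ D g₁ ∧ IsEmb B₂ D g₂ ∧ (∀ a, g₁ (f₁ a) = g₂ (f₂ a)) ∧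
    (∀ d : D.carrier, (∃ b, g₁ b = d) ∨ (∃ b, g₂ b = d)) ∧
    (∀ b₁ b₂, g₁ b₁ = g₂ b₂ → ∃ a, f₁ a = b₁ ∧ f₂ a = b₂) ∧
    ∀ (s : σ.symbols) (t : Fin (σ.arity s) → D.carrier), t ∈ D.rel s →
      (∃ t' ∈ B₁.rel s, ∀ j, g₁ (t' j) = t j) ∨ (∃ t' ∈ B₂.rel s, ∀ j, g₂ (t' j) = t j)

/-- The age of `U` has the free amalgamation property. -/
def AgeFAP (U : RelStr σ) : Prop :=
  ∀ A B₁ B₂ : RelStr σ, inAge U A → inAge U B₁ → inAge U B₂ →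
    ∀ (f₁ : A.carrier → B₁.carrier) (f₂ : A.carrier → B₂.carrier),
      IsEmb A B₁ f₁ → IsEmb A B₂ f₂ →
      ∃ (D : RelStr σ) (g₁ : B₁.carrier → D.carrier) (g₂ : B₂.carrier → D.carrier),
        inAge U D ∧ IsFreeAmalgam A B₁ B₂ D f₁ f₂ g₁ g₂

/-- The age of `U` is closed with respect to finite products. -/
def AgeClosedUnderProducts (U : RelStr σ) : Prop :=
  ∀ A B : RelStr σ, inAge U A → inAge U B → inAge U (A.prod B)

/-- The age of `U` has the homo-amalgamation property (HAP). -/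
def AgeHAP (U : RelStr σ) : Prop :=
  ∀ A B C : RelStr σ, inAge U A → inAge U B → inAge U C →
    ∀ (f : A.carrier → B.carrier) (g : A.carrier → C.carrier),
      IsHom A B f → IsEmb A C g →
      ∃ (D : RelStr σ) (f' : C.carrier → D.carrier) (g' : B.carrier → D.carrier),
        inAge U D ∧ IsHom C D f' ∧ IsEmb B D g' ∧ ∀ a, f' (g a) = g' (f a)

end RelStr

open RelStr

/-! ## Primitive positive formulas -/

/-- Primitive positive formulas with `n` free variables. -/
inductive PP (σ : RelSig) : ℕ → Type
  | eq : ∀ {n : ℕ}, Fin n → Fin n → PP σ n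
  | rel : ∀ {n : ℕ} (s : σ.symbols), (Fin (σ.arity s) → Fin n) → PP σ n
  | and : ∀ {n : ℕ}, PP σ n → PP σ n → PP σ n
  | ex : ∀ {n : ℕ}, PP σ (n + 1) → PP σ n

/-- Satisfaction of a primitive positive formula. -/
def PP.Sat {σ : RelSig} (U : RelStr σ) : ∀ {n : ℕ}, PP σ n → (Fin n → U.carrier) → Prop
  | _, .eq i j, t => t i = t j
  | _, .rel s v, t => (fun k => t (v k)) ∈ U.rel s
  | _, .and φ ψ, t => PP.Sat U φ t ∧ PP.Sat U ψ t
  | _, .ex φ, t => ∃ a : U.carrier, PP.Sat U φ (Fin.snoc t a)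

/-- Quantifier-free primitive positive formulas. -/
def PP.QFree {σ : RelSig} : ∀ {n : ℕ}, PP σ n → Prop
  | _, .eq _ _ => True
  | _, .rel _ _ => True
  | _, .and φ ψ => PP.QFree φ ∧ PP.QFree ψ
  | _, .ex _ => False

/-- `U` has quantifier elimination for primitive positive formulas. -/
def HasPPQE {σ : RelSig} (U : RelStr σ) : Prop :=
  ∀ (n : ℕ) (φ : PP σ n), ∃ ψ : PP σ n, PP.QFree ψ ∧
    ∀ t : Fin n → U.carrier, PP.Sat U φ t ↔ PP.Sat U ψ t

/-! ## Polymorphisms -/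

/-- An `n`-ary polymorphism of `U`: a homomorphism `Uⁿ → U`. -/
def IsPolymorphism {σ : RelSig} (U : RelStr σ) (n : ℕ)
    (u : (Fin n → U.carrier) → U.carrier) : Prop :=
  IsHom (U.pow n) U u

/-- Universal `n`-ary polymorphism. -/
def IsUniversalPolymorphism {σ : RelSig} (U : RelStr σ) (n : ℕ)
    (u : (Fin n → U.carrier) → U.carrier) : Prop :=
  IsPolymorphism U n u ∧
    ∀ A : RelStr σ, Countable A.carrier → Younger A U →
      ∀ f : (Fin n → A.carrier) → U.carrier, IsHom (A.pow n) U f →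
        ∃ ι : A.carrier → U.carrier, IsEmb A U ι ∧
          ∀ t : Fin n → A.carrier, f t = u (fun i => ι (t i))

/-- Homogeneous `n`-ary polymorphism. -/
def IsHomogeneousPolymorphism {σ : RelSig} (U : RelStr σ) (n : ℕ)
    (u : (Fin n → U.carrier) → U.carrier) : Prop :=
  IsPolymorphism U n u ∧
    ∀ A : RelStr σ, inAge U A →
      ∀ f : (Fin n → A.carrier) → U.carrier, IsHom (A.pow n) U f →
        ∀ ι₁ ι₂ : A.carrier → U.carrier, IsEmb A U ι₁ → IsEmb A U ι₂ →
          (∀ t : Fin n → A.carrier, u (fun i => ι₁ (t i)) = f t) →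
          (∀ t : Fin n → A.carrier, u (fun i => ι₂ (t i)) = f t) →
          ∃ h : U.carrier → U.carrier, IsAut U h ∧ (∀ a, h (ι₁ a) = ι₂ a) ∧
            ∀ t : Fin n → U.carrier, u (fun i => h (t i)) = u t

/-! ## Clones of finitary operations

Operations of arity `n + 1` are indexed by `n : ℕ`, so that all arities are `≥ 1`. -/

structure Clone (U : Type) where
  ops : ∀ n : ℕ, Set ((Fin (n + 1) → U) → U)
  proj_mem : ∀ (n : ℕ) (i : Fin (n + 1)), (fun x => x i) ∈ ops n
  comp_mem : ∀ {n m : ℕ} (f : (Fin (n + 1) → U) → U) (g : Fin (n + 1) → (Fin (m + 1) → U) → U),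
      f ∈ ops n → (∀ i, g i ∈ ops m) → (fun x => f fun i => g i x) ∈ ops m

/-- The underlying set of a clone: the disjoint sum of its arity fibers. -/
abbrev Clone.Elem {U : Type} (C : Clone U) : Type := Σ n : ℕ, ↥(C.ops n)

/-- The polymorphism clone of a relational structure. -/
def polClone {σ : RelSig} (U : RelStr σ) : Clone U.carrier where
  ops n := {f | IsPolymorphism U (n + 1) f}
  proj_mem n i := fun s t ht => ht i
  comp_mem f g hf hg := fun s t ht => hf s (fun j i => g i (t j)) (fun i => hg i s t ht)

/-- The topology of pointwise convergence (the carrier being discrete) on the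
space of `n+1`-ary operations on `U`. -/
def fnTop (U : Type) (n : ℕ) : TopologicalSpace ((Fin (n + 1) → U) → U) :=
  letI : TopologicalSpace U := ⊥
  inferInstance

/-- The topology of pointwise convergence on an arity fiber of a clone. -/
def opsTop {U : Type} (C : Clone U) (n : ℕ) : TopologicalSpace ↥(C.ops n) :=
  letI : TopologicalSpace U := ⊥
  inferInstance

/-- The canonical topology on a clone: the sum over all arities of the topologies
of pointwise convergence. -/
def cloneTop {U : Type} (C : Clone U) : TopologicalSpace C.Elem :=
  letI : TopologicalSpace U := ⊥
  inferInstance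

/-- Clone homomorphisms: arity preserving maps preserving projections and composition. -/
structure CloneHom {U V : Type} (C : Clone U) (D : Clone V) where
  app : ∀ n : ℕ, ↥(C.ops n) → ↥(D.ops n)
  map_proj : ∀ (n : ℕ) (i : Fin (n + 1)),
    (app n ⟨fun x => x i, C.proj_mem n i⟩).val = fun x => x i
  map_comp : ∀ (n m : ℕ) (f : ↥(C.ops n)) (g : Fin (n + 1) → ↥(C.ops m)),
    (app m ⟨fun x => f.val fun i => (g i).val x,
        C.comp_mem f.val (fun i => (g i).val) f.property (fun i => (g i).property)⟩).val
      = fun x => (app n f).val fun i => (app m (g i)).val x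

/-- The action of a clone homomorphism on the underlying sets. -/
def CloneHom.elemMap {U V : Type} {C : Clone U} {D : Clone V} (h : CloneHom C D) :
    C.Elem → D.Elem :=
  fun p => ⟨p.1, h.app p.1 p.2⟩

/-- Application of a unary operation (in the `Fin 1` encoding) to a point. -/
def ap1 {U : Type} (φ : (Fin 1 → U) → U) (u : U) : U := φ (fun _ => u)

/-- The group of units of the unary part of a clone. -/
def cloneUnits {U : Type} (C : Clone U) : Set ((Fin 1 → U) → U) :=
  {φ | φ ∈ C.ops 0 ∧ ∃ ψ ∈ C.ops 0, (∀ u, ap1 φ (ap1 ψ u) = u) ∧ ∀ u, ap1 ψ (ap1 φ u) = u}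

/-- The closure of the group of units inside the unary part of a clone. -/
def unitClosure {U : Type} (C : Clone U) : Set ((Fin 1 → U) → U) :=
  C.ops 0 ∩ @closure _ (fnTop U 0) (cloneUnits C)

/-- Cauchy sequences of functions with respect to the complete ultrametric of
pointwise convergence (discrete codomain): at every argument, the sequence of
values is eventually constant. -/
def PtwCauchy {α U : Type} (g : ℕ → α → U) : Prop :=
  ∀ x : α, ∃ N : ℕ, ∀ m, N ≤ m → ∀ m', N ≤ m' → g m x = g m' x

/-- Pointwise convergence of a sequence of functions (discrete codomain). -/
def PtwConv {α β : Type} (g : ℕ → α → β) (f : α → β) : Prop :=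
  ∀ x : α, ∃ N : ℕ, ∀ j, N ≤ j → g j x = f x

/-- A strong gate covering of a clone. -/
def StrongGateCovering {U : Type} (C : Clone U) : Prop :=
  ∃ (𝒰 : Set (Set C.Elem)) (F : ∀ V ∈ 𝒰, C.Elem),
    (∀ V ∈ 𝒰, @IsOpen _ (cloneTop C) V) ∧
    (∀ p : C.Elem, ∃ V ∈ 𝒰, p ∈ V) ∧
    (∀ V (hV : V ∈ 𝒰), F V hV ∈ V) ∧
    ∀ V (hV : V ∈ 𝒰) (k : ℕ) (g : ℕ → ↥(C.ops k)),
      (∀ j : ℕ, (⟨k, g j⟩ : C.Elem) ∈ V) →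
      PtwCauchy (fun j => (g j).val) →
      ∃ fV : ↥(C.ops k), F V hV = ⟨k, fV⟩ ∧
        ∃ (κ : ℕ → (Fin 1 → U) → U) (ι : Fin (k + 1) → ℕ → (Fin 1 → U) → U),
          (∀ j, κ j ∈ unitClosure C) ∧ (∀ i j, ι i j ∈ unitClosure C) ∧
          PtwCauchy κ ∧ (∀ i, PtwCauchy (ι i)) ∧
          ∀ (j : ℕ) (x : Fin (k + 1) → U),
            (g j).val x = ap1 (κ j) (fV.val fun i => ap1 (ι i j) (x i))

/-- A closed (sub)clone of the clone of all operations. -/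
def IsClosedClone {U : Type} (C : Clone U) : Prop :=
  ∀ n : ℕ, @IsClosed _ (fnTop U n) (C.ops n)

/-! ## Posets as relational structures -/

/-- The signature with a single binary relation symbol. -/
def sigOrd : RelSig := ⟨Unit, fun _ => 2⟩

/-- A (reflexive) partial order viewed as a relational structure. -/
def ordStruc (P : Type) [PartialOrder P] : RelStr sigOrd where
  carrier := P
  rel _ := {t : Fin 2 → P | t 0 ≤ t 1}

/-! ## The amalgamation extension property AEPⁿ and the homo-amalgamation property HAPⁿ -/

/-- A class `𝒞` of relational structures has the AEPⁿ. -/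
def HasAEPn {σ : RelSig} (𝒞 : RelStr σ → Prop) (n : ℕ) : Prop :=
  ∀ A B₁ B₂ T : RelStr σ, 𝒞 A → 𝒞 B₁ → 𝒞 B₂ → 𝒞 T →
    ∀ (f₁ : A.carrier → B₁.carrier) (f₂ : A.carrier → B₂.carrier),
      RelStr.IsEmb A B₁ f₁ → RelStr.IsEmb A B₂ f₂ →
      ∀ (h₁ : (Fin n → B₁.carrier) → T.carrier) (h₂ : (Fin n → B₂.carrier) → T.carrier),
        RelStr.IsHom (B₁.pow n) T h₁ → RelStr.IsHom (B₂.pow n) T h₂ →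
        (∀ t : Fin n → A.carrier, h₁ (fun i => f₁ (t i)) = h₂ (fun i => f₂ (t i))) →
        ∃ (C T' : RelStr σ) (g₁ : B₁.carrier → C.carrier) (g₂ : B₂.carrier → C.carrier)
            (k : T.carrier → T'.carrier) (h : (Fin n → C.carrier) → T'.carrier),
          𝒞 C ∧ 𝒞 T' ∧ RelStr.IsEmb B₁ C g₁ ∧ RelStr.IsEmb B₂ C g₂ ∧
            (∀ a, g₁ (f₁ a) = g₂ (f₂ a)) ∧ RelStr.IsEmb T T' k ∧
            RelStr.IsHom (C.pow n) T' h ∧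
            (∀ t : Fin n → B₁.carrier, h (fun i => g₁ (t i)) = k (h₁ t)) ∧
            (∀ t : Fin n → B₂.carrier, h (fun i => g₂ (t i)) = k (h₂ t))

/-- A class `𝒞` of relational structures has the HAPⁿ. -/
def HasHAPn {σ : RelSig} (𝒞 : RelStr σ → Prop) (n : ℕ) : Prop :=
  ∀ A B T₁ : RelStr σ, 𝒞 A → 𝒞 B → 𝒞 T₁ →
    ∀ (g : A.carrier → B.carrier) (a : (Fin n → A.carrier) → T₁.carrier),
      RelStr.IsEmb A B g → RelStr.IsHom (A.pow n) T₁ a →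
      ∃ (T₂ : RelStr σ) (h : T₁.carrier → T₂.carrier) (b : (Fin n → B.carrier) → T₂.carrier),
        𝒞 T₂ ∧ RelStr.IsEmb T₁ T₂ h ∧ RelStr.IsHom (B.pow n) T₂ b ∧
          ∀ t : Fin n → A.carrier, b (fun i => g (t i)) = h (a t)
theorem tendsto_opsTop_iff {U : Type} (C : Clone U) (n : ℕ) (g : ℕ → ↥(C.ops n))
    (f : ↥(C.ops n)) :
    Filter.Tendsto g Filter.atTop (@nhds _ (opsTop C n) f) ↔
      PtwConv (fun j => (g j).val) f.val := by
  let _ : TopologicalSpace U := ⊥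
  have : DiscreteTopology U := ⟨rfl⟩
  change Filter.Tendsto g Filter.atTop (nhds f) ↔ _
  rw [tendsto_subtype_rng, tendsto_pi_nhds]
  simp only [nhds_discrete, Filter.tendsto_pure, Filter.eventually_atTop]
  rfl

theorem firstCountableTopology_opsTop {U : Type} [Countable U] (C : Clone U) (n : ℕ) :
    @FirstCountableTopology _ (opsTop C n) := by
  let _ : TopologicalSpace U := ⊥
  have : DiscreteTopology U := ⟨rfl⟩
  change FirstCountableTopology ↥(C.ops n)
  infer_instance

theorem continuous_opsTop_of_ptwConv {U V : Type} [Countable U] {C : Clone U} {D : Clone V}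
    {n m : ℕ} (F : ↥(C.ops n) → ↥(D.ops m))
    (hF : ∀ (g : ℕ → ↥(C.ops n)) (f : ↥(C.ops n)), PtwConv (fun j => (g j).val) f.val →
      PtwConv (fun j => (F (g j)).val) (F f).val) :
    @Continuous _ _ (opsTop C n) (opsTop D m) F := by
  let _ := opsTop C n
  let _ := opsTop D m
  have := firstCountableTopology_opsTop C n
  refine continuous_iff_seqContinuous.2 fun g f hg => ?_
  exact (tendsto_opsTop_iff D m _ _).2 (hF g f ((tendsto_opsTop_iff C n g f).1 hg))

theorem ptwConv_of_continuousOn_opsTop {U V : Type} {C : Clone U} {D : Clone V}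
    {n m : ℕ} {F : ↥(C.ops n) → ↥(D.ops m)} {S : Set ↥(C.ops n)}
    (hF : @ContinuousOn _ _ (opsTop C n) (opsTop D m) F S)
    {g : ℕ → ↥(C.ops n)} {f : ↥(C.ops n)} (hg : ∀ j, g j ∈ S) (hf : f ∈ S)
    (hgf : PtwConv (fun j => (g j).val) f.val) :
    PtwConv (fun j => (F (g j)).val) (F f).val := by
  let _ := opsTop C n
  let _ := opsTop D m
  refine (tendsto_opsTop_iff D m _ _).1 ((hF f hf).tendsto.comp ?_)
  exact tendsto_nhdsWithin_iff.2
    ⟨(tendsto_opsTop_iff C n g f).2 hgf, Filter.Eventually.of_forall hg⟩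

theorem PtwCauchy.exists_ptwConv {α U : Type} {g : ℕ → α → U} (hg : PtwCauchy g) :
    ∃ f : α → U, PtwConv g f := by
  choose N hN using hg
  exact ⟨fun x => g (N x) x, fun x => ⟨N x, fun j hj => hN x j hj _ le_rfl⟩⟩

theorem PtwConv.ptwCauchy {α U : Type} {g : ℕ → α → U} {f : α → U} (hg : PtwConv g f) :
    PtwCauchy g := fun x => by
  obtain ⟨N, hN⟩ := hg x
  exact ⟨N, fun m hm m' hm' => (hN m hm).trans (hN m' hm').symm⟩

theorem PtwConv.comp_add {α U : Type} {g : ℕ → α → U} {f : α → U} (hg : PtwConv g f) (M : ℕ) :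
    PtwConv (fun j => g (j + M)) f := fun x => by
  obtain ⟨N, hN⟩ := hg x
  exact ⟨N, fun j hj => hN _ (by lia)⟩

theorem PtwConv.of_comp_add {α U : Type} {g : ℕ → α → U} {f : α → U} {M : ℕ}
    (hg : PtwConv (fun j => g (j + M)) f) : PtwConv g f := fun x => by
  obtain ⟨N, hN⟩ := hg x
  refine ⟨N + M, fun j hj => ?_⟩
  simpa only [Nat.sub_add_cancel (show M ≤ j by lia)] using hN (j - M) (by lia)

theorem ptwConv_iff_eventually {α U : Type} {g : ℕ → α → U} {f : α → U} :
    PtwConv g f ↔ ∀ x, ∀ᶠ j in Filter.atTop, g j x = f x := by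
  simp only [PtwConv, Filter.eventually_atTop]

theorem PtwConv.unique {α U : Type} {g : ℕ → α → U} {f f' : α → U} (hf : PtwConv g f)
    (hf' : PtwConv g f') : f = f' := by
  funext x
  obtain ⟨j, hj, hj'⟩ :=
    ((ptwConv_iff_eventually.1 hf x).and (ptwConv_iff_eventually.1 hf' x)).exists
  exact hj.symm.trans hj'

theorem PtwConv.isPolymorphism {σ : RelSig} {A : RelStr σ} {n : ℕ}
    {g : ℕ → (Fin n → A.carrier) → A.carrier} {f : (Fin n → A.carrier) → A.carrier}
    (hgf : PtwConv g f) (hg : ∀ j, IsPolymorphism A n (g j)) : IsPolymorphism A n f := by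
  intro s t ht
  obtain ⟨j, hj⟩ :=
    (Filter.eventually_all.2 fun i => ptwConv_iff_eventually.1 hgf (t i)).exists
  have := hg j s t ht
  rwa [show (fun i => f (t i)) = fun i => g j (t i) from funext fun i => (hj i).symm]

theorem PtwConv.mem_unitClosure_polClone {σ : RelSig} {A : RelStr σ}
    {g : ℕ → (Fin 1 → A.carrier) → A.carrier} {f : (Fin 1 → A.carrier) → A.carrier}
    (hgf : PtwConv g f) (hg : ∀ j, g j ∈ unitClosure (polClone A)) :
    f ∈ unitClosure (polClone A) := by
  refine ⟨hgf.isPolymorphism fun j => (hg j).1, ?_⟩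
  let _ : TopologicalSpace A.carrier := ⊥
  have : DiscreteTopology A.carrier := ⟨rfl⟩
  have hlim : Filter.Tendsto g Filter.atTop (nhds f) := by
    refine tendsto_pi_nhds.2 fun x => ?_
    rw [nhds_discrete, Filter.tendsto_pure]
    exact ptwConv_iff_eventually.1 hgf x
  exact isClosed_closure.mem_of_tendsto hlim (Filter.Eventually.of_forall fun j => (hg j).2)

theorem PtwConv.ap1_gate {U : Type} {k : ℕ} (f : (Fin (k + 1) → U) → U)
    {κ : ℕ → (Fin 1 → U) → U} {ι : Fin (k + 1) → ℕ → (Fin 1 → U) → U}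
    {κ' : (Fin 1 → U) → U} {ι' : Fin (k + 1) → (Fin 1 → U) → U}
    (hκ : PtwConv κ κ') (hι : ∀ i, PtwConv (ι i) (ι' i)) :
    PtwConv (fun j (x : Fin (k + 1) → U) => ap1 (κ j) (f fun i => ap1 (ι i j) (x i)))
      (fun x => ap1 κ' (f fun i => ap1 (ι' i) (x i))) := by
  refine ptwConv_iff_eventually.2 fun x => ?_
  filter_upwards [Filter.eventually_all.2 fun i =>
      ptwConv_iff_eventually.1 (hι i) (fun _ => x i),
    ptwConv_iff_eventually.1 hκ (fun _ => f fun i => ap1 (ι' i) (x i))] with j hj hj'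
  have : (fun i => ap1 (ι i j) (x i)) = fun i => ap1 (ι' i) (x i) := funext hj
  rw [this]
  exact hj'

theorem CloneHom.app_gate {U V : Type} {C : Clone U} {D : Clone V} (h : CloneHom C D) {k : ℕ}
    (g f : ↥(C.ops k)) (κ : ↥(C.ops 0)) (ι : Fin (k + 1) → ↥(C.ops 0))
    (hg : ∀ x, g.val x = ap1 κ.val (f.val fun i => ap1 (ι i).val (x i)))
    (x : Fin (k + 1) → V) :
    (h.app k g).val x =
      ap1 (h.app 0 κ).val ((h.app k f).val fun i => ap1 (h.app 0 (ι i)).val (x i)) := by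
  let p : Fin (k + 1) → ↥(C.ops k) := fun i => ⟨fun x => x i, C.proj_mem k i⟩
  let q : Fin (k + 1) → ↥(C.ops k) := fun i =>
    ⟨fun x => (ι i).val fun _ => (p i).val x,
      C.comp_mem _ _ (ι i).property fun _ => (p i).property⟩
  let r : ↥(C.ops k) :=
    ⟨fun x => f.val fun i => (q i).val x, C.comp_mem _ _ f.property fun i => (q i).property⟩
  have hgr : g = ⟨fun x => κ.val fun _ => r.val x,
      C.comp_mem _ _ κ.property fun _ => r.property⟩ := Subtype.ext (funext hg)
  have hq (i) : (h.app k (q i)).val = fun x => ap1 (h.app 0 (ι i)).val (x i) := by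
    rw [h.map_comp 0 k (ι i) (fun _ => p i), h.map_proj k i]
    rfl
  rw [hgr, h.map_comp 0 k κ (fun _ => r), h.map_comp k k f q]
  simp only [hq]
  rfl

/-- The key sequential step: `h` preserves limits of sequences staying inside a single member
of a strong gate covering. -/
theorem CloneHom.ptwConv_app_of_gate {σ τ : RelSig} {A : RelStr σ} {B : RelStr τ}
    (h : CloneHom (polClone A) (polClone B))
    (hres : @ContinuousOn _ _ (opsTop (polClone A) 0) (opsTop (polClone B) 0)
      (h.app 0) {φ : ↥((polClone A).ops 0) | φ.val ∈ unitClosure (polClone A)})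
    {k : ℕ} {g : ℕ → ↥((polClone A).ops k)} {f fV : ↥((polClone A).ops k)}
    (hgf : PtwConv (fun j => (g j).val) f.val)
    {κ : ℕ → (Fin 1 → A.carrier) → A.carrier}
    {ι : Fin (k + 1) → ℕ → (Fin 1 → A.carrier) → A.carrier}
    (hκ : ∀ j, κ j ∈ unitClosure (polClone A)) (hι : ∀ i j, ι i j ∈ unitClosure (polClone A))
    (hκc : PtwCauchy κ) (hιc : ∀ i, PtwCauchy (ι i))
    (hg : ∀ j x, (g j).val x = ap1 (κ j) (fV.val fun i => ap1 (ι i j) (x i))) :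
    PtwConv (fun j => (h.app k (g j)).val) (h.app k f).val := by
  obtain ⟨κ', hκ'⟩ := hκc.exists_ptwConv
  choose ι' hι' using fun i => (hιc i).exists_ptwConv
  have hκm := hκ'.mem_unitClosure_polClone hκ
  have hιm := fun i => (hι' i).mem_unitClosure_polClone (hι i)
  have hf : f.val = fun x => ap1 κ' (fV.val fun i => ap1 (ι' i) (x i)) := by
    refine hgf.unique ?_
    rw [show (fun j => (g j).val) = fun j x => ap1 (κ j) (fV.val fun i => ap1 (ι i j) (x i))
      from funext fun j => funext (hg j)]
    exact PtwConv.ap1_gate _ hκ' hι'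
  have key := PtwConv.ap1_gate (h.app k fV).val
    (ptwConv_of_continuousOn_opsTop hres (g := fun j => ⟨κ j, (hκ j).1⟩)
      (f := ⟨κ', hκm.1⟩) hκ hκm hκ')
    (fun i => ptwConv_of_continuousOn_opsTop hres (g := fun j => ⟨ι i j, (hι i j).1⟩)
      (f := ⟨ι' i, (hιm i).1⟩) (hι i) (hιm i) (hι' i))
  have hgj (j) := funext (h.app_gate (g j) fV ⟨κ j, (hκ j).1⟩
    (fun i => ⟨ι i j, (hι i j).1⟩) (hg j))
  have hfx := funext (h.app_gate f fV ⟨κ', hκm.1⟩ (fun i => ⟨ι' i, (hιm i).1⟩) (congrFun hf))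
  rw [hfx, funext hgj]
  exact key

/-- Let `A` and `B` be countable relational structures such that `Pol(A)`
has a strong gate covering.  Every clone homomorphism `h : Pol(A) → Pol(B)` whose
restriction to the closure of `Aut(A)` (= the closure of the group of units) inside the
unary part of `Pol(A)` is continuous, is itself continuous. -/
theorem stmt_0 {σ τ : RelSig} (A : RelStr σ) (B : RelStr τ)
    (hcA : Countable A.carrier) (hcB : Countable B.carrier)
    (hsgc : StrongGateCovering (polClone A))
    (h : CloneHom (polClone A) (polClone B))
    (hres : @ContinuousOn _ _ (opsTop (polClone A) 0) (opsTop (polClone B) 0)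
      (h.app 0) {φ : ↥((polClone A).ops 0) | φ.val ∈ unitClosure (polClone A)}) :
    @Continuous _ _ (cloneTop (polClone A)) (cloneTop (polClone B)) h.elemMap := by
  have hfib (k : ℕ) : @Continuous _ _ (opsTop (polClone A) k) (opsTop (polClone B) k)
      (h.app k) := by
    obtain ⟨𝒰, F, hopen, hcov, -, hgate⟩ := hsgc
    refine continuous_opsTop_of_ptwConv _ fun g f hgf => ?_
    obtain ⟨V, hV, hfV⟩ := hcov ⟨k, f⟩
    let _ := opsTop (polClone A) k
    have hpre : IsOpen {p : ↥((polClone A).ops k) | (⟨k, p⟩ : (polClone A).Elem) ∈ V} :=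
      (@isOpen_sigma_iff _ _ (opsTop (polClone A)) V).1 (hopen V hV) k
    have hev : ∀ᶠ j in Filter.atTop, (⟨k, g j⟩ : (polClone A).Elem) ∈ V :=
      ((tendsto_opsTop_iff _ k g f).2 hgf).eventually_mem (hpre.mem_nhds hfV)
    obtain ⟨M, hM⟩ := Filter.eventually_atTop.1 hev
    have hgM := hgf.comp_add M
    obtain ⟨fV, -, κ, ι, hκ, hι, hκc, hιc, hg⟩ :=
      hgate V hV k (fun j => g (j + M)) (fun j => hM _ (by lia)) hgM.ptwCauchy
    exact (h.ptwConv_app_of_gate hres hgM hκ hι hκc hιc hg).of_comp_add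
  let _ : TopologicalSpace A.carrier := ⊥
  let _ : TopologicalSpace B.carrier := ⊥
  exact continuous_sigma fun k => continuous_sigmaMk.comp (hfib k)
end

section
/- Let A and B be countable sets and let M₁ and M₂ be submonoids of the full transformation monoids on A and on B, respectively, such that the set of invertible elements (units) of M₁ is dense in M₁. Then every continuous monoid homomorphism h : M₁ → M₂ is uniformly continuous from (M₁, d_A) to (M₂, d_B). -/
set_option autoImplicit false

/-! For a countable set `A`, the space `A → A` carries the topology of pointwise
convergence with `A` discrete; this topology is induced by the complete ultrametric
coming from an enumeration of `A`, or equivalently by the product uniformity of the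
discrete (`⊥`) uniformity.  Uniform continuity below is with respect to these product
uniformities. -/

/-- The topology of pointwise convergence on `A → A` (`A` discrete). -/
def funTop (A : Type) : TopologicalSpace (A → A) :=
  letI : TopologicalSpace A := ⊥
  inferInstance

/-- The topology of pointwise convergence on a set of transformations. -/
def subTop {A : Type} (M : Set (A → A)) : TopologicalSpace ↥M :=
  letI : TopologicalSpace A := ⊥
  inferInstance

/-- The product uniformity (the discrete uniformity on `A`) on a set of
transformations; it induces the topology of pointwise convergence and is the
uniformity of the canonical complete ultrametric `d_A`. -/
def subUnif {A : Type} (M : Set (A → A)) : UniformSpace ↥M :=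
  letI : UniformSpace A := ⊥
  inferInstance

theorem exists_mem_eqOn_of_mem_closure {A : Type} {S : Set (A → A)} {f : A → A}
    (hf : f ∈ @closure _ (funTop A) S) (F : Finset A) :
    ∃ g ∈ S, ∀ a ∈ F, g a = f a := by
  let : TopologicalSpace A := ⊥
  have : DiscreteTopology A := ⟨rfl⟩
  have hF : Set.pi (F : Set A) (fun a => {f a}) ∈ nhds f :=
    set_pi_mem_nhds F.finite_toSet fun a _ => (isOpen_discrete _).mem_nhds rfl
  obtain ⟨g, hg, hgS⟩ := mem_closure_iff_nhds.1 hf _ hF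
  exact ⟨g, hgS, fun a ha => hg a ha⟩

theorem exists_finset_apply_eq_of_continuous {A B : Type} {M₁ : Set (A → A)}
    {M₂ : Set (B → B)} {h : ↥M₁ → ↥M₂}
    (hcont : @Continuous _ _ (subTop M₁) (subTop M₂) h) (f : ↥M₁) (b : B) :
    ∃ F : Finset A, ∀ g : ↥M₁, (∀ a ∈ F, g.val a = f.val a) →
      (h g).val b = (h f).val b := by
  let : TopologicalSpace A := ⊥
  let : TopologicalSpace B := ⊥
  have : DiscreteTopology A := ⟨rfl⟩
  have : DiscreteTopology B := ⟨rfl⟩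
  have hc : Continuous fun g : ↥M₁ => (h g).val b :=
    (continuous_apply b).comp (continuous_subtype_val.comp hcont)
  have hV : {g : ↥M₁ | (h g).val b = (h f).val b} ∈ nhds f :=
    hc.continuousAt.preimage_mem_nhds ((isOpen_discrete {(h f).val b}).mem_nhds rfl)
  rw [nhds_subtype_eq_comap, Filter.mem_comap] at hV
  obtain ⟨U, hU, hUV⟩ := hV
  rw [nhds_pi, Filter.mem_pi] at hU
  obtain ⟨I, hI, t, ht, htU⟩ := hU
  refine ⟨hI.toFinset, fun g hg => hUV (htU fun a ha => ?_)⟩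
  rw [hg a (hI.mem_toFinset.2 ha)]
  exact mem_of_mem_nhds (ht a)

theorem uniformContinuous_of_forall_exists_finset {A B : Type} {M₁ : Set (A → A)}
    {M₂ : Set (B → B)} {h : ↥M₁ → ↥M₂}
    (H : ∀ b : B, ∃ F : Finset A, ∀ f g : ↥M₁, (∀ a ∈ F, f.val a = g.val a) →
      (h f).val b = (h g).val b) :
    @UniformContinuous _ _ (subUnif M₁) (subUnif M₂) h := by
  let : UniformSpace A := ⊥
  let : UniformSpace B := ⊥
  change UniformContinuous h
  refine UniformContinuous.subtype_mk (f := fun f => (h f).val) ?_ fun f => (h f).property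
  refine uniformContinuous_pi.2 fun b => ?_
  obtain ⟨F, hF⟩ := H b
  have hF' : ∀ᶠ p in uniformity ↥M₁, ∀ a ∈ F, p.1.val a = p.2.val a := by
    refine (Filter.eventually_all_finset F).2 fun a _ => ?_
    have ha : UniformContinuous fun f : ↥M₁ => f.val a :=
      (Pi.uniformContinuous_proj _ a).comp uniformContinuous_subtype_val
    exact ha (Filter.mem_principal_self _)
  intro V hV
  rw [Filter.mem_map]
  filter_upwards [hF'] with p hp
  change ((h p.1).val b, (h p.2).val b) ∈ V
  rw [hF p.1 p.2 hp]
  exact refl_mem_uniformity hV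

/-- Let `A` and `B` be countable sets and let `M₁` and `M₂` be
transformation monoids on `A` resp. `B` such that the set of units of `M₁` is dense
in `M₁`.  Then every continuous monoid homomorphism `h : M₁ → M₂` is uniformly
continuous from `(M₁, d_A)` to `(M₂, d_B)`. -/
theorem stmt_1 {A B : Type} (hA : Countable A) (hB : Countable B)
    (M₁ : Set (A → A)) (M₂ : Set (B → B))
    (h₁id : id ∈ M₁) (h₁comp : ∀ f ∈ M₁, ∀ g ∈ M₁, f ∘ g ∈ M₁)
    (h₂id : id ∈ M₂) (h₂comp : ∀ f ∈ M₂, ∀ g ∈ M₂, f ∘ g ∈ M₂)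
    (hdense : M₁ ⊆ @closure _ (funTop A)
      {f | f ∈ M₁ ∧ ∃ g ∈ M₁, f ∘ g = id ∧ g ∘ f = id})
    (h : ↥M₁ → ↥M₂)
    (hid : (h ⟨id, h₁id⟩).val = id)
    (hcomp : ∀ f g : ↥M₁,
      (h ⟨f.val ∘ g.val, h₁comp f.val f.property g.val g.property⟩).val
        = (h f).val ∘ (h g).val)
    (hcont : @Continuous _ _ (subTop M₁) (subTop M₂) h) :
    @UniformContinuous _ _ (subUnif M₁) (subUnif M₂) h := by
  refine uniformContinuous_of_forall_exists_finset fun b => ?_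
  obtain ⟨F, hF⟩ := exists_finset_apply_eq_of_continuous hcont ⟨id, h₁id⟩ b
  have key : ∀ f g : ↥M₁, (∃ k ∈ M₁, g.val ∘ k = id ∧ k ∘ g.val = id) →
      (∀ a ∈ F, f.val a = g.val a) → (h f).val b = (h g).val b := by
    rintro f g ⟨k, hk, hgk, hkg⟩ hfg
    have hfix := hF ⟨k ∘ f.val, h₁comp k hk f.val f.property⟩ fun a ha => by
      simpa [hfg a ha] using congrFun hkg a
    have hf := hcomp g ⟨k ∘ f.val, h₁comp k hk f.val f.property⟩
    simp only [← Function.comp_assoc, hgk, Function.id_comp] at hf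
    rw [hf, Function.comp_apply, hfix, hid, id]
  refine ⟨F, fun f g hfg => ?_⟩
  obtain ⟨u, ⟨hu, huinv⟩, hug⟩ := exists_mem_eqOn_of_mem_closure (hdense g.property) F
  rw [key f ⟨u, hu⟩ huinv fun a ha => (hfg a ha).trans (hug a ha).symm,
    key g ⟨u, hu⟩ huinv fun a ha => (hug a ha).symm]
end

section
/- Let U be a countable, homogeneous, ω-categorical relational structure such that (1) Aut(U) acts transitively on U, (2) Age(U) has the free amalgamation property, (3) Age(U) is closed with respect to finite products, and (4) Age(U) has the homo-amalgamation property (HAP). Then every continuous clone isomorphism from Pol(U) to another closed subclone of O_U is a homeomorphism. -/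
set_option autoImplicit false

open RelStr

namespace RelStr

variable {σ : RelSig}

/-- The substructure induced on a set of points. -/
def induced (U : RelStr σ) (A : Set U.carrier) : RelStr σ where
  carrier := A
  rel s := {t | (fun j => (t j).1) ∈ U.rel s}

theorem isEmb_induced_val (U : RelStr σ) (A : Set U.carrier) :
    IsEmb (U.induced A) U Subtype.val :=
  ⟨Subtype.val_injective, fun _ _ => Iff.rfl⟩

theorem inAge_induced (U : RelStr σ) {A : Set U.carrier} (hA : A.Finite) :
    inAge U (U.induced A) :=
  ⟨hA, Subtype.val, U.isEmb_induced_val A⟩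

theorem isEmb_induced_inclusion (U : RelStr σ) {A B : Set U.carrier} (h : A ⊆ B) :
    IsEmb (U.induced A) (U.induced B) (Set.inclusion h) :=
  ⟨Set.inclusion_injective h, fun _ _ => Iff.rfl⟩

theorem IsEmb.isHom {A B : RelStr σ} {f : A.carrier → B.carrier} (h : IsEmb A B f) :
    IsHom A B f :=
  fun s t => (h.2 s t).1

theorem IsEmb.comp {A B C : RelStr σ} {g : B.carrier → C.carrier} {f : A.carrier → B.carrier}
    (hg : IsEmb B C g) (hf : IsEmb A B f) : IsEmb A C (g ∘ f) :=
  ⟨hg.1.comp hf.1, fun s t => (hf.2 s t).trans (hg.2 s _)⟩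

/-- A locally determined, extendable family of finite approximations has a limit. -/
theorem exists_limit {V W : Type} [Countable V] [Nonempty W]
    (P : Set V → (V → W) → Prop)
    (hlocal : ∀ A κ κ', (∀ a ∈ A, κ a = κ' a) → P A κ → P A κ')
    (hext : ∀ A B κ, A.Finite → B.Finite → A ⊆ B → P A κ →
      ∃ κ', P B κ' ∧ ∀ a ∈ A, κ' a = κ a)
    {A₀ : Set V} (hA₀ : A₀.Finite) {κ₀ : V → W} (h₀ : P A₀ κ₀) :
    ∃ κ, (∀ a ∈ A₀, κ a = κ₀ a) ∧ ∀ A : Set V, A.Finite → ∃ B, A ⊆ B ∧ P B κ := by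
  obtain ⟨code, hcode⟩ := exists_injective_nat V
  set S : ℕ → Set V := fun n => A₀ ∪ {v | code v < n} with hS
  have hSfin : ∀ n, (S n).Finite := fun n =>
    hA₀.union ((Set.finite_lt_nat n).preimage hcode.injOn)
  have hSmono : Monotone S := fun m n hmn v hv =>
    hv.imp id fun h => lt_of_lt_of_le h hmn
  have hS0 : S 0 = A₀ := by simp [hS]
  have step : ∀ n (κ : {κ // P (S n) κ}), ∃ κ' : {κ // P (S (n + 1)) κ},
      ∀ a ∈ S n, κ'.1 a = κ.1 a := fun n κ => by
    obtain ⟨κ', h, h'⟩ := hext _ _ κ.1 (hSfin n) (hSfin (n + 1)) (hSmono n.le_succ) κ.2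
    exact ⟨⟨κ', h⟩, h'⟩
  choose next hnext using step
  let seq : ∀ n, {κ // P (S n) κ} := fun n =>
    Nat.rec ⟨κ₀, hS0.symm ▸ h₀⟩ (fun n κ => next n κ) n
  have hseq : ∀ m n, m ≤ n → ∀ a ∈ S m, (seq n).1 a = (seq m).1 a := by
    intro m n hmn
    induction n, hmn using Nat.le_induction with
    | base => exact fun _ _ => rfl
    | succ n hmn ih =>
      exact fun a ha => (hnext n (seq n) a (hSmono hmn ha)).trans (ih a ha)
  have hmem : ∀ v, v ∈ S (code v + 1) := fun v => Or.inr (Nat.lt_succ_self _)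
  have hlim : ∀ n, ∀ a ∈ S n, (seq n).1 a = (seq (code a + 1)).1 a := fun n a ha => by
    rcases le_total n (code a + 1) with h | h
    · exact (hseq _ _ h a ha).symm
    · exact hseq _ _ h a (hmem a)
  refine ⟨fun v => (seq (code v + 1)).1 v, fun a ha => ?_, fun A hA => ?_⟩
  · exact (hlim 0 a (hS0 ▸ ha)).symm
  · obtain ⟨N, hN⟩ := (hA.image code).bddAbove
    exact ⟨S (N + 1), fun a ha => Or.inr (Nat.lt_succ_of_le (hN ⟨a, ha, rfl⟩)),
      hlocal _ _ _ (hlim (N + 1)) (seq (N + 1)).2⟩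

theorem exists_isEmb_of_finite_inAge {U V : RelStr σ} [Countable V.carrier]
    [Nonempty U.carrier] (hhom : IsHomogeneous U)
    (hV : ∀ A : Set V.carrier, A.Finite → inAge U (V.induced A)) :
    ∃ ι, IsEmb V U ι := by
  classical
  obtain ⟨ι₀, h₀⟩ := (hV ∅ Set.finite_empty).2
  have h₁ : IsEmb (V.induced ∅) U (fun a => (fun _ => Classical.arbitrary U.carrier) a.1) := by
    convert h₀ using 1
    exact funext fun a => a.2.elim
  have hlim := exists_limit (κ₀ := fun _ => Classical.arbitrary U.carrier)
    (P := fun A κ => IsEmb (V.induced A) U (fun a => κ a.1)) ?_ ?_ Set.finite_empty h₁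
  · obtain ⟨κ, -, hκ⟩ := hlim
    refine ⟨κ, fun v w hvw => ?_, fun s t => ?_⟩
    · obtain ⟨B, hAB, hB⟩ := hκ {v, w} (Set.toFinite _)
      exact congrArg Subtype.val
        (@hB.1 ⟨v, hAB (by simp)⟩ ⟨w, hAB (by simp)⟩ hvw)
    · obtain ⟨B, hAB, hB⟩ := hκ (Set.range t) (Set.finite_range t)
      exact hB.2 s fun j => ⟨t j, hAB ⟨j, rfl⟩⟩
  · intro A κ κ' h hκ
    convert hκ using 1
    exact funext fun a => (h a.1 a.2).symm
  · intro A B κ hA hB hAB hκ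
    obtain ⟨ι, hι⟩ := (hV B hB).2
    obtain ⟨a, ha, haι⟩ := hhom _ (hV A hA) _ _
      (hι.comp (V.isEmb_induced_inclusion hAB)) hκ
    refine ⟨fun v => if hv : v ∈ B then a (ι ⟨v, hv⟩) else κ v, ?_, fun v hv => ?_⟩
    · convert ha.2.comp hι using 1
      exact funext fun v => dif_pos v.2
    · exact (dif_pos (hAB hv)).trans (haι ⟨v, hv⟩)

theorem inAge.of_isEmb {U B C : RelStr σ} (hB : inAge U B) {f : C.carrier → B.carrier}
    (hf : IsEmb C B f) : inAge U C := by
  obtain ⟨hfin, ι, hι⟩ := hB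
  exact ⟨Finite.of_injective f hf.1, _, hι.comp hf⟩

theorem exists_injective_binary_polymorphism {U : RelStr σ} [Countable U.carrier]
    [Nonempty U.carrier] (hhom : IsHomogeneous U) (hprod : AgeClosedUnderProducts U) :
    ∃ ι : U.carrier × U.carrier → U.carrier, Function.Injective ι ∧ IsHom (U.prod U) U ι := by
  have : Countable (U.prod U).carrier := inferInstanceAs (Countable (U.carrier × U.carrier))
  obtain ⟨ι, hι⟩ := exists_isEmb_of_finite_inAge (V := U.prod U) hhom fun A hA => by
    refine inAge.of_isEmb
      (hprod _ _ (U.inAge_induced (hA.image Prod.fst)) (U.inAge_induced (hA.image Prod.snd)))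
      (f := fun a => (⟨a.1.1, a.1, a.2, rfl⟩, ⟨a.1.2, a.1, a.2, rfl⟩))
      ⟨fun a b hab => ?_, fun s t => Iff.rfl⟩
    exact Subtype.ext (Prod.ext (congrArg (fun c => c.1.1) hab) (congrArg (fun c => c.2.1) hab))
  exact ⟨ι, hι.1, hι.isHom⟩

open Classical in
/-- The second copy of `U` in the free amalgam of `U` with itself over the complement of `y`. -/
noncomputable def secondCopy {X : Type} (y u : X) : Option X :=
  if u = y then none else some u

theorem secondCopy_self {X : Type} (y : X) : secondCopy y y = none := if_pos rfl

theorem secondCopy_of_ne {X : Type} {y u : X} (h : u ≠ y) : secondCopy y u = some u := if_neg h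

theorem eq_of_secondCopy_eq_some {X : Type} {y u v : X} (h : secondCopy y u = some v) :
    u = v := by
  by_cases hu : u = y
  · subst hu
    simp [secondCopy_self] at h
  · simpa [secondCopy_of_ne hu] using h

theorem secondCopy_injective {X : Type} (y : X) : Function.Injective (secondCopy y) := by
  intro u v h
  by_cases hv : v = y
  · subst hv
    by_contra hu
    simp [secondCopy_self, secondCopy_of_ne hu] at h
  · exact eq_of_secondCopy_eq_some (h.trans (secondCopy_of_ne hv))

/-- The free amalgam of `U` with itself over the complement of `y`. -/
def double (U : RelStr σ) (y : U.carrier) : RelStr σ where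
  carrier := Option U.carrier
  rel s := {t | (∃ t' ∈ U.rel s, ∀ j, t j = some (t' j)) ∨
    ∃ t' ∈ U.rel s, ∀ j, t j = secondCopy y (t' j)}

theorem inAge_induced_double {U : RelStr σ} (hfap : AgeFAP U) (y : U.carrier)
    {A : Set (Option U.carrier)} (hA : A.Finite) : inAge U ((U.double y).induced A) := by
  classical
  set C : Set U.carrier := insert y (some ⁻¹' A) with hC
  have hCfin : C.Finite := (hA.preimage (Option.some_injective _).injOn).insert y
  have hyC : y ∈ C := Set.mem_insert _ _
  have hsub : C \ {y} ⊆ C := Set.sdiff_subset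
  have hi := U.isEmb_induced_inclusion hsub
  obtain ⟨D, g₁, g₂, hD, hg₁, hg₂, hcomm, -, hglue, hrel⟩ :=
    hfap _ _ _ (U.inAge_induced (hCfin.subset hsub)) (U.inAge_induced hCfin)
      (U.inAge_induced hCfin) _ _ hi hi
  let φ : Option U.carrier → D.carrier := fun o =>
    o.elim (g₂ ⟨y, hyC⟩) fun u => if hu : u ∈ C then g₁ ⟨u, hu⟩ else g₂ ⟨y, hyC⟩
  have hφ₁ : ∀ u : (U.induced C).carrier, φ (some u.1) = g₁ u := fun u => dif_pos u.2
  have hφ₂ : ∀ u : (U.induced C).carrier, φ (secondCopy y u.1) = g₂ u := by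
    rintro ⟨u, hu⟩
    by_cases huy : u = y
    · subst huy
      simp [secondCopy_self, φ]
    · rw [secondCopy_of_ne huy]
      exact (hφ₁ ⟨u, hu⟩).trans (hcomm ⟨u, hu, huy⟩)
  have hne : ∀ u, g₁ u ≠ g₂ ⟨y, hyC⟩ := fun u hu => by
    obtain ⟨a, -, ha⟩ := hglue _ _ hu
    exact a.2.2 (congrArg Subtype.val ha)
  have hAC : ∀ u, some u ∈ A → u ∈ C := fun u hu => Or.inr hu
  have hinj : ∀ o o', (∀ u, o = some u → u ∈ C) → (∀ u, o' = some u → u ∈ C) →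
      φ o = φ o' → o = o' := by
    rintro (_ | u) (_ | v) hu hv h
    · rfl
    · rw [hφ₁ ⟨v, hv v rfl⟩] at h
      exact (hne _ h.symm).elim
    · rw [hφ₁ ⟨u, hu u rfl⟩] at h
      exact (hne _ h).elim
    · rw [hφ₁ ⟨u, hu u rfl⟩, hφ₁ ⟨v, hv v rfl⟩] at h
      exact congrArg (fun c => some c.1) (hg₁.1 h)
  have hmem₂ : ∀ u, secondCopy y u ∈ A → u ∈ C := fun u hu => by
    by_cases huy : u = y
    · exact huy ▸ hyC
    · exact hAC u (secondCopy_of_ne huy ▸ hu)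
  have hmemA : ∀ o ∈ A, ∀ u, o = some u → u ∈ C := fun o ho u hu => hAC u (hu ▸ ho)
  refine hD.of_isEmb (f := fun a => φ a.1) ⟨fun a b hab => ?_, fun s t => ⟨?_, fun ht => ?_⟩⟩
  · exact Subtype.ext (hinj _ _ (hmemA _ a.2) (hmemA _ b.2) hab)
  · rintro (⟨t', ht', h⟩ | ⟨t', ht', h⟩)
    · have hm : ∀ j, t' j ∈ C := fun j => hmemA _ (t j).2 _ (h j)
      have := (hg₁.2 s fun j => ⟨t' j, hm j⟩).1 ht'
      convert this using 2 with j
      exact (congrArg φ (h j)).trans (hφ₁ ⟨t' j, hm j⟩)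
    · have hm : ∀ j, t' j ∈ C := fun j => hmem₂ _ (h j ▸ (t j).2)
      have := (hg₂.2 s fun j => ⟨t' j, hm j⟩).1 ht'
      convert this using 2 with j
      exact (congrArg φ (h j)).trans (hφ₂ ⟨t' j, hm j⟩)
  · rcases hrel s _ ht with ⟨t', ht', h⟩ | ⟨t', ht', h⟩
    · refine Or.inl ⟨_, ht', fun j => ?_⟩
      refine hinj _ _ (hmemA _ (t j).2) (fun u hu => ?_) ((h j).symm.trans (hφ₁ _).symm)
      exact Option.some_injective _ hu ▸ (t' j).2
    · refine Or.inr ⟨_, ht', fun j => ?_⟩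
      refine hinj _ _ (hmemA _ (t j).2) (fun u hu => ?_) ((h j).symm.trans (hφ₂ _).symm)
      exact eq_of_secondCopy_eq_some hu ▸ (t' j).2

theorem exists_endomorphisms_differing_at {U : RelStr σ} [Countable U.carrier]
    (hhom : IsHomogeneous U) (hfap : AgeFAP U) (y : U.carrier) :
    ∃ e e', IsHom U U e ∧ IsHom U U e' ∧ (∀ u, u ≠ y → e u = e' u) ∧ e y ≠ e' y := by
  have : Nonempty U.carrier := ⟨y⟩
  have : Countable (U.double y).carrier := inferInstanceAs (Countable (Option U.carrier))
  obtain ⟨ι, hι⟩ := exists_isEmb_of_finite_inAge (V := U.double y) hhom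
    fun A hA => inAge_induced_double hfap y hA
  refine ⟨fun u => ι (some u), fun u => ι (secondCopy y u),
    fun s t ht => hι.isHom s _ (Or.inl ⟨t, ht, fun _ => rfl⟩),
    fun s t ht => hι.isHom s _ (Or.inr ⟨t, ht, fun _ => rfl⟩),
    fun u hu => by simp only [secondCopy_of_ne hu], fun h => ?_⟩
  have := hι.1 h
  rw [secondCopy_self] at this
  cases this

end RelStr

/-- The unary member of the polymorphism clone given by an endomorphism. -/
def polUnary {σ : RelSig} {U : RelStr σ} (e : U.carrier → U.carrier) (he : IsHom U U e) :
    ↥((polClone U).ops 0) :=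
  ⟨fun v => e (v 0), fun s _ ht => he s _ (ht 0)⟩

/-- Composition in a clone. -/
def Clone.comp {U : Type} (C : Clone U) {n m : ℕ} (f : ↥(C.ops n))
    (g : Fin (n + 1) → ↥(C.ops m)) : ↥(C.ops m) :=
  ⟨fun x => f.val fun i => (g i).val x,
    C.comp_mem f.val (fun i => (g i).val) f.property fun i => (g i).property⟩

/-- Under an injective clone homomorphism, the value of a polymorphism at a tuple is determined
by the value of its image at a suitable tuple. -/
theorem CloneHom.exists_detecting_tuple {σ : RelSig} {U : RelStr σ} [Countable U.carrier]
    (hhom : IsHomogeneous U) (htrans : AutTransitive U) (hfap : AgeFAP U)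
    (hprod : AgeClosedUnderProducts U) {V : Type} {D : Clone V} (h : CloneHom (polClone U) D)
    (hinj : Function.Injective (h.app 0)) {n : ℕ} (f : ↥((polClone U).ops n))
    (x : Fin (n + 1) → U.carrier) :
    ∃ q : Fin (n + 1) → V, ∀ g : ↥((polClone U).ops n),
      (h.app n g).val q = (h.app n f).val q → g.val x = f.val x := by
  have : Nonempty U.carrier := ⟨x 0⟩
  obtain ⟨ι, hι, hιhom⟩ := exists_injective_binary_polymorphism hhom hprod
  choose a ha hax using fun i => htrans (x 0) (x i)
  let pair : ↥((polClone U).ops 1) :=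
    ⟨fun v => ι (v 0, v 1), fun s _ ht => hιhom s _ ⟨ht 0, ht 1⟩⟩
  let diag : ↥((polClone U).ops n) → ↥((polClone U).ops 0) := fun g =>
    (polClone U).comp g fun i => polUnary (a i) (ha i).2.isHom
  let graph : ↥((polClone U).ops n) → ↥((polClone U).ops 0) := fun g =>
    (polClone U).comp pair ![diag g, ⟨fun v => v 0, (polClone U).proj_mem 0 0⟩]
  have hgraph : ∀ g v, (graph g).val v = ι (g.val fun i => a i (v 0), v 0) := fun _ _ => rfl
  set y := (graph f).val fun _ => x 0 with hy
  obtain ⟨e, e', he, he', hagree, hdiff⟩ := exists_endomorphisms_differing_at hhom hfap y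
  have hne : (polClone U).comp (polUnary e he) (fun _ => graph f) ≠
      (polClone U).comp (polUnary e' he') (fun _ => graph f) := fun heq =>
    hdiff (congrFun (congrArg Subtype.val heq) fun _ => x 0)
  obtain ⟨p, hp⟩ := Function.ne_iff.1 fun heq => hne (hinj (Subtype.ext heq))
  refine ⟨fun i => (h.app 0 (polUnary (a i) (ha i).2.isHom)).val p, fun g hg => ?_⟩
  have hdiag : (h.app 0 (diag g)).val p = (h.app 0 (diag f)).val p :=
    (congrFun (h.map_comp n 0 g _) p).trans (hg.trans (congrFun (h.map_comp n 0 f _) p).symm)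
  have hgf : (h.app 0 (graph g)).val p = (h.app 0 (graph f)).val p := by
    refine (congrFun (h.map_comp 1 0 pair _) p).trans
      (Eq.trans (congrArg _ (funext fun i => ?_)) (congrFun (h.map_comp 1 0 pair _) p).symm)
    refine Fin.cases hdiag (fun i => ?_) i
    rw [Subsingleton.elim i 0]
    rfl
  have hcomp : ∀ (k : ↥((polClone U).ops 0)),
      (h.app 0 ((polClone U).comp k fun _ => graph g)).val p =
        (h.app 0 ((polClone U).comp k fun _ => graph f)).val p := fun k =>
    (congrFun (h.map_comp 0 0 k _) p).trans
      ((congrArg _ (funext fun _ => hgf)).trans (congrFun (h.map_comp 0 0 k _) p).symm)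
  have hmem : ∃ v, (graph g).val v = y := by
    by_contra! hcon
    apply hp
    rw [← hcomp, ← hcomp]
    refine congrArg (fun k => (h.app 0 k).val p) (Subtype.ext (funext fun v => ?_))
    exact hagree _ (hcon v)
  obtain ⟨v, hv⟩ := hmem
  rw [hy, hgraph, hgraph] at hv
  obtain ⟨h₁, h₂⟩ := Prod.ext_iff.1 (hι hv)
  have h₂ : v 0 = x 0 := h₂
  simpa only [h₂, hax] using h₁

theorem CloneHom.isOpenMap_elemMap {U V : Type} {C : Clone U} {D : Clone V} (h : CloneHom C D)
    (hbij : ∀ n, Function.Bijective (h.app n))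
    (hdet : ∀ n (f : ↥(C.ops n)) (x : Fin (n + 1) → U), ∃ q : Fin (n + 1) → V,
      ∀ g : ↥(C.ops n), (h.app n g).val q = (h.app n f).val q → g.val x = f.val x) :
    @IsOpenMap _ _ (cloneTop C) (cloneTop D) h.elemMap := by
  let _ : TopologicalSpace U := ⊥
  let _ : TopologicalSpace V := ⊥
  have : DiscreteTopology U := ⟨rfl⟩
  have : DiscreteTopology V := ⟨rfl⟩
  change IsOpenMap (fun p : C.Elem => (⟨p.1, h.app p.1 p.2⟩ : D.Elem))
  refine isOpenMap_sigma.2 fun n => ?_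
  suffices IsOpenMap (h.app n) from isOpenMap_sigmaMk.comp this
  let e := Equiv.ofBijective _ (hbij n)
  refine (e.continuous_symm_iff).1 ?_
  refine continuous_induced_rng.2 (continuous_pi fun x => ?_)
  refine continuous_iff_continuousAt.2 fun d => ?_
  obtain ⟨q, hq⟩ := hdet n (e.symm d) x
  refine ContinuousAt.congr (f := fun _ => (e.symm d).val x) continuousAt_const ?_
  have hev : Continuous fun d' : ↥(D.ops n) => d'.val q :=
    (continuous_apply q).comp continuous_subtype_val
  filter_upwards [(isOpen_discrete {d.val q}).preimage hev |>.mem_nhds rfl] with d' hd'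
  refine (hq (e.symm d') ?_).symm
  exact (congrArg (fun k => k.val q) (e.apply_symm_apply d')).trans
    (hd'.trans (congrArg (fun k => k.val q) (e.apply_symm_apply d)).symm)

/-- Let `U` be a countable, homogeneous, ω-categorical relational
structure such that `Aut(U)` acts transitively on `U`, `Age(U)` has the free
amalgamation property, is closed with respect to finite products, and has the
homo-amalgamation property.  Then every continuous clone isomorphism from `Pol(U)` to
another closed subclone of `O_U` is a homeomorphism. -/
theorem stmt_5 {σ : RelSig} (U : RelStr σ)
    (hc : Countable U.carrier)
    (hhom : RelStr.IsHomogeneous U)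
    (homega : RelStr.IsOligomorphic U)
    (htrans : RelStr.AutTransitive U)
    (hfap : RelStr.AgeFAP U)
    (hprod : RelStr.AgeClosedUnderProducts U)
    (hhap : RelStr.AgeHAP U)
    (D : Clone U.carrier) (hD : IsClosedClone D)
    (h : CloneHom (polClone U) D)
    (hbij : ∀ n : ℕ, Function.Bijective (h.app n))
    (hcont : @Continuous _ _ (cloneTop (polClone U)) (cloneTop D) h.elemMap) :
    @IsHomeomorph _ _ (cloneTop (polClone U)) (cloneTop D) h.elemMap := by
  refine @IsHomeomorph.mk _ _ (cloneTop _) (cloneTop _) _ hcont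
    (h.isOpenMap_elemMap hbij fun n f x =>
      h.exists_detecting_tuple hhom htrans hfap hprod (hbij 0).1 f x)
    ⟨?_, ?_⟩
  · rintro ⟨n, f⟩ ⟨m, g⟩ hfg
    obtain ⟨rfl, hfg⟩ := Sigma.mk.inj hfg
    exact congrArg (Sigma.mk n) ((hbij n).1 (eq_of_heq hfg))
  · rintro ⟨n, d⟩
    obtain ⟨f, rfl⟩ := (hbij n).2 d
    exact ⟨⟨n, f⟩, rfl⟩
end

section
/- The class of finite posets has well-behaved amalgamated free sums. Concretely: let A₁ ≤ B₁₁, A₁ ≤ B₁₂ be finite posets with B₁₁ ∩ B₁₂ = A₁, and A₂ ≤ B₂₁, A₂ ≤ B₂₂ finite posets with B₂₁ ∩ B₂₂ = A₂. Let C₁ = B₁₁ ⊕_{A₁} B₁₂ and C₂ = B₂₁ ⊕_{A₂} B₂₂ be the poset amalgamated free sums, and let D = (B₁₁ × B₂₁) ⊕_{A₁×A₂} (B₁₂ × B₂₂). Then D is a subposet of C₁ × C₂; that is, D ⊆ C₁ × C₂ as sets, and the order of D coincides with the restriction of the product order of C₁ × C₂ to D². -/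
set_option autoImplicit false

/-- `r` is a partial order on (exactly) the subset `B` of `γ`. -/
structure PartialOrderOn {γ : Type} (B : Set γ) (r : γ → γ → Prop) : Prop where
  support : ∀ x y, r x y → x ∈ B ∧ y ∈ B
  refl : ∀ x ∈ B, r x x
  antisymm : ∀ x y, r x y → r y x → x = y
  trans : ∀ x y z, r x y → r y z → r x z

/-- The order relation of the amalgamated free sum `B₁ ⊕_A B₂` of two posets
(`r₁` the order on `B₁`, `r₂` the order on `B₂`, `A` the common part):
`x ≤ y` iff `x ≤ y` holds in `B₁` or in `B₂`, or there is `a ∈ A` with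
`x ≤_{B₁} a ≤_{B₂} y`, or there is `a ∈ A` with `x ≤_{B₂} a ≤_{B₁} y`. -/
def amalgLE {γ : Type} (A : Set γ) (r₁ r₂ : γ → γ → Prop) : γ → γ → Prop :=
  fun x y => r₁ x y ∨ r₂ x y ∨ (∃ a ∈ A, r₁ x a ∧ r₂ a y) ∨ (∃ a ∈ A, r₂ x a ∧ r₁ a y)

/-- The componentwise (product) order relation. -/
def prodRel {γ δ : Type} (r : γ → γ → Prop) (s : δ → δ → Prop) : γ × δ → γ × δ → Prop :=
  fun p q => r p.1 q.1 ∧ s p.2 q.2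

/-- The product of two partial orders is a partial order on the product of the carriers. -/
theorem PartialOrderOn.prod {γ δ : Type} {B : Set γ} {C : Set δ} {r : γ → γ → Prop}
    {s : δ → δ → Prop} (hr : PartialOrderOn B r) (hs : PartialOrderOn C s) :
    PartialOrderOn (B ×ˢ C) (prodRel r s) where
  support _ _ h :=
    ⟨⟨(hr.support _ _ h.1).1, (hs.support _ _ h.2).1⟩,
      ⟨(hr.support _ _ h.1).2, (hs.support _ _ h.2).2⟩⟩
  refl _ h := ⟨hr.refl _ h.1, hs.refl _ h.2⟩
  antisymm _ _ h h' := Prod.ext (hr.antisymm _ _ h.1 h'.1) (hs.antisymm _ _ h.2 h'.2)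
  trans _ _ _ h h' := ⟨hr.trans _ _ _ h.1 h'.1, hs.trans _ _ _ h.2 h'.2⟩

section amalgLE

variable {γ : Type} {B₁ B₂ : Set γ} {r₁ r₂ : γ → γ → Prop}

theorem amalgLE_swap {x y : γ} :
    amalgLE (B₁ ∩ B₂) r₁ r₂ x y ↔ amalgLE (B₂ ∩ B₁) r₂ r₁ x y := by
  rw [Set.inter_comm]
  unfold amalgLE
  rw [or_left_comm, or_comm (a := ∃ a ∈ B₂ ∩ B₁, r₁ x a ∧ r₂ a y)]

/-- The amalgamated order restricts to the given order on the first summand. -/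
theorem amalgLE_iff_left (h₁ : PartialOrderOn B₁ r₁) (h₂ : PartialOrderOn B₂ r₂)
    (hagr : ∀ x ∈ B₁ ∩ B₂, ∀ y ∈ B₁ ∩ B₂, (r₁ x y ↔ r₂ x y)) {x y : γ}
    (hx : x ∈ B₁) (hy : y ∈ B₁) : amalgLE (B₁ ∩ B₂) r₁ r₂ x y ↔ r₁ x y := by
  refine ⟨?_, Or.inl⟩
  rintro (h | h | ⟨a, ha, h, h'⟩ | ⟨a, ha, h, h'⟩)
  · exact h
  · have hs := h₂.support _ _ h
    exact (hagr x ⟨hx, hs.1⟩ y ⟨hy, hs.2⟩).2 h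
  · exact h₁.trans _ _ _ h ((hagr a ha y ⟨hy, (h₂.support _ _ h').2⟩).2 h')
  · exact h₁.trans _ _ _ ((hagr x ⟨hx, (h₂.support _ _ h).1⟩ a ha).2 h) h'

/-- The amalgamated order from the first to the second summand factors through the
common part. -/
theorem amalgLE_iff_exists (h₁ : PartialOrderOn B₁ r₁) (h₂ : PartialOrderOn B₂ r₂)
    (hagr : ∀ x ∈ B₁ ∩ B₂, ∀ y ∈ B₁ ∩ B₂, (r₁ x y ↔ r₂ x y)) {x y : γ}
    (hx : x ∈ B₁) (hy : y ∈ B₂) :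
    amalgLE (B₁ ∩ B₂) r₁ r₂ x y ↔ ∃ a ∈ B₁ ∩ B₂, r₁ x a ∧ r₂ a y := by
  refine ⟨?_, fun h => Or.inr (Or.inr (Or.inl h))⟩
  rintro (h | h | h | ⟨a, ha, h, h'⟩)
  · exact ⟨y, ⟨(h₁.support _ _ h).2, hy⟩, h, h₂.refl y hy⟩
  · exact ⟨x, ⟨hx, (h₂.support _ _ h).1⟩, h₁.refl x hx, h⟩
  · exact h
  · exact ⟨a, ha, (hagr x ⟨hx, (h₂.support _ _ h).1⟩ a ha).2 h,
      (hagr a ha y ⟨(h₁.support _ _ h').2, hy⟩).1 h'⟩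

end amalgLE

section prod

variable {γ δ : Type} {B₁₁ B₁₂ : Set γ} {B₂₁ B₂₂ : Set δ}
  {r₁₁ r₁₂ : γ → γ → Prop} {r₂₁ r₂₂ : δ → δ → Prop}

theorem prodRel_agree
    (hagr₁ : ∀ x ∈ B₁₁ ∩ B₁₂, ∀ y ∈ B₁₁ ∩ B₁₂, (r₁₁ x y ↔ r₁₂ x y))
    (hagr₂ : ∀ x ∈ B₂₁ ∩ B₂₂, ∀ y ∈ B₂₁ ∩ B₂₂, (r₂₁ x y ↔ r₂₂ x y)) :
    ∀ x ∈ (B₁₁ ×ˢ B₂₁) ∩ (B₁₂ ×ˢ B₂₂), ∀ y ∈ (B₁₁ ×ˢ B₂₁) ∩ (B₁₂ ×ˢ B₂₂),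
      (prodRel r₁₁ r₂₁ x y ↔ prodRel r₁₂ r₂₂ x y) := fun x hx y hy =>
  and_congr (hagr₁ x.1 ⟨hx.1.1, hx.2.1⟩ y.1 ⟨hy.1.1, hy.2.1⟩)
    (hagr₂ x.2 ⟨hx.1.2, hx.2.2⟩ y.2 ⟨hy.1.2, hy.2.2⟩)

/-- The comparison of the two orders, for a first argument in the first summand. -/
theorem amalgLE_prodRel_iff
    (h₁₁ : PartialOrderOn B₁₁ r₁₁) (h₁₂ : PartialOrderOn B₁₂ r₁₂)
    (h₂₁ : PartialOrderOn B₂₁ r₂₁) (h₂₂ : PartialOrderOn B₂₂ r₂₂)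
    (hagr₁ : ∀ x ∈ B₁₁ ∩ B₁₂, ∀ y ∈ B₁₁ ∩ B₁₂, (r₁₁ x y ↔ r₁₂ x y))
    (hagr₂ : ∀ x ∈ B₂₁ ∩ B₂₂, ∀ y ∈ B₂₁ ∩ B₂₂, (r₂₁ x y ↔ r₂₂ x y))
    {p q : γ × δ} (hp : p ∈ B₁₁ ×ˢ B₂₁) (hq : q ∈ (B₁₁ ×ˢ B₂₁) ∪ (B₁₂ ×ˢ B₂₂)) :
    amalgLE ((B₁₁ ×ˢ B₂₁) ∩ (B₁₂ ×ˢ B₂₂)) (prodRel r₁₁ r₂₁) (prodRel r₁₂ r₂₂) p q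
      ↔ amalgLE (B₁₁ ∩ B₁₂) r₁₁ r₁₂ p.1 q.1 ∧ amalgLE (B₂₁ ∩ B₂₂) r₂₁ r₂₂ p.2 q.2 := by
  have hagr := prodRel_agree hagr₁ hagr₂
  rcases hq with hq | hq
  · rw [amalgLE_iff_left (h₁₁.prod h₂₁) (h₁₂.prod h₂₂) hagr hp hq,
      amalgLE_iff_left h₁₁ h₁₂ hagr₁ hp.1 hq.1, amalgLE_iff_left h₂₁ h₂₂ hagr₂ hp.2 hq.2,
      prodRel]
  · rw [amalgLE_iff_exists (h₁₁.prod h₂₁) (h₁₂.prod h₂₂) hagr hp hq,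
      amalgLE_iff_exists h₁₁ h₁₂ hagr₁ hp.1 hq.1, amalgLE_iff_exists h₂₁ h₂₂ hagr₂ hp.2 hq.2]
    constructor
    · rintro ⟨a, ha, h, h'⟩
      exact ⟨⟨a.1, ⟨ha.1.1, ha.2.1⟩, h.1, h'.1⟩, ⟨a.2, ⟨ha.1.2, ha.2.2⟩, h.2, h'.2⟩⟩
    · rintro ⟨⟨a, ha, h, h'⟩, ⟨b, hb, k, k'⟩⟩
      exact ⟨(a, b), ⟨⟨ha.1, hb.1⟩, ⟨ha.2, hb.2⟩⟩, ⟨h, k⟩, ⟨h', k'⟩⟩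

end prod

/-- The class of finite posets has well-behaved amalgamated free sums:
with `C₁ = B₁₁ ⊕_{A₁} B₁₂` and `C₂ = B₂₁ ⊕_{A₂} B₂₂` poset amalgamated free sums
(`A₁ = B₁₁ ∩ B₁₂`, `A₂ = B₂₁ ∩ B₂₂`), the poset
`D = (B₁₁ × B₂₁) ⊕_{A₁ × A₂} (B₁₂ × B₂₂)` is a subposet of `C₁ × C₂`: its carrier is
contained in `C₁ × C₂` and its order coincides with the restriction of the product
order of `C₁ × C₂`. -/
theorem stmt_13 {γ δ : Type} [Finite γ] [Finite δ]
    (B₁₁ B₁₂ : Set γ) (B₂₁ B₂₂ : Set δ)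
    (hcov₁ : B₁₁ ∪ B₁₂ = Set.univ) (hcov₂ : B₂₁ ∪ B₂₂ = Set.univ)
    (r₁₁ r₁₂ : γ → γ → Prop) (r₂₁ r₂₂ : δ → δ → Prop)
    (h₁₁ : PartialOrderOn B₁₁ r₁₁) (h₁₂ : PartialOrderOn B₁₂ r₁₂)
    (h₂₁ : PartialOrderOn B₂₁ r₂₁) (h₂₂ : PartialOrderOn B₂₂ r₂₂)
    (hagr₁ : ∀ x ∈ B₁₁ ∩ B₁₂, ∀ y ∈ B₁₁ ∩ B₁₂, (r₁₁ x y ↔ r₁₂ x y))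
    (hagr₂ : ∀ x ∈ B₂₁ ∩ B₂₂, ∀ y ∈ B₂₁ ∩ B₂₂, (r₂₁ x y ↔ r₂₂ x y)) :
    ∀ p ∈ (B₁₁ ×ˢ B₂₁) ∪ (B₁₂ ×ˢ B₂₂), ∀ q ∈ (B₁₁ ×ˢ B₂₁) ∪ (B₁₂ ×ˢ B₂₂),
      (amalgLE ((B₁₁ ×ˢ B₂₁) ∩ (B₁₂ ×ˢ B₂₂)) (prodRel r₁₁ r₂₁) (prodRel r₁₂ r₂₂) p q
        ↔ amalgLE (B₁₁ ∩ B₁₂) r₁₁ r₁₂ p.1 q.1 ∧ amalgLE (B₂₁ ∩ B₂₂) r₂₁ r₂₂ p.2 q.2) := by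
  intro p hp q hq
  rcases hp with hp | hp
  · exact amalgLE_prodRel_iff h₁₁ h₁₂ h₂₁ h₂₂ hagr₁ hagr₂ hp hq
  · rw [amalgLE_swap (B₁ := B₁₁ ×ˢ B₂₁), amalgLE_swap (B₁ := B₁₁), amalgLE_swap (B₁ := B₂₁)]
    exact amalgLE_prodRel_iff h₁₂ h₁₁ h₂₂ h₂₁
      (fun x hx y hy => (hagr₁ x hx.symm y hy.symm).symm)
      (fun x hx y hy => (hagr₂ x hx.symm y hy.symm).symm) hp hq.symm
end
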